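/- arXiv:1906.01951 — 2 statements merged into one kernel-verified Lean document; each statement's English description precedes it below -/
import Mathlib

section
/- Let Λ be a commutative ring, P the poset of simplices of a finite simplicial complex (including the empty simplex), and M = (M_*, M^*) a Mackey ΛP-module. Then the colimit over P of M_* is isomorphic as a Λ-module to the direct sum ⊕_{σ ∈ P} S_σ M_*, where S_σ M_* = M_*(σ)/Σ_{τ < σ} im(M_*(τ ≤ σ)). -/
open Finset DirectSum

/-- An alternating sum over the subsets of `s` vanishes if the summand ignores some `v ∈ s`. -/
theorem sum_powerset_neg_one_pow_smul_eq_zero {V A : Type*} [DecidableEq V] [AddCommGroup A]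
    {s : Finset V} {v : V} (hv : v ∈ s) (h : Finset V → A)
    (hins : ∀ t ⊆ s, h (insert v t) = h t) :
    ∑ t ∈ s.powerset, (-1 : ℤ) ^ #t • h t = 0 := by
  rw [← insert_erase hv, sum_powerset_insert (notMem_erase v s), ← sum_add_distrib]
  refine sum_eq_zero fun t ht => ?_
  have hts : t ⊆ s.erase v := mem_powerset.mp ht
  have hvt : v ∉ t := fun h => notMem_erase v s (hts h)
  rw [card_insert_of_notMem hvt, hins t (hts.trans (erase_subset v s)), pow_succ]
  simp

/-- Möbius inversion on the Boolean lattice: the alternating sum over the interval `[r, s]`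
is concentrated at `r = s`. -/
theorem sum_powerset_neg_one_pow_smul_ite {V A : Type*} [DecidableEq V] [AddCommGroup A]
    (r s : Finset V) (a : A) :
    ∑ t ∈ s.powerset, (-1 : ℤ) ^ #t • (if r ⊆ t then a else 0) =
      if r = s then (-1 : ℤ) ^ #s • a else 0 := by
  split_ifs with hrs
  · subst hrs
    rw [sum_eq_single_of_mem r (mem_powerset_self r)]
    · simp
    · intro t ht htr
      rw [if_neg fun h => htr (subset_antisymm (mem_powerset.mp ht) h), smul_zero]
  · by_cases hsub : r ⊆ s
    · obtain ⟨v, hvs, hvr⟩ := exists_of_ssubset (hsub.ssubset_of_ne hrs)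
      exact sum_powerset_neg_one_pow_smul_eq_zero hvs _ fun t _ => by
        simp only [subset_insert_iff_of_notMem hvr]
    · refine sum_eq_zero fun t ht => ?_
      rw [if_neg fun h => hsub (h.trans (mem_powerset.mp ht)), smul_zero]

/-- Let `P` be the simplex poset (empty simplex included) of a finite simplicial complex,
modelled as a subset-closed collection `K` of finite subsets of a finite vertex set `V`, and
`(M, cov, con)` a Mackey `ΛP`-module.  If `N` together with the maps `f_σ : M σ → N` is a
colimit of the covariant functor `M` over `P` (expressed by the universal property), then
`N ≅ ⊕_{σ ∈ P} S_σ M` as `Λ`-modules, where `S_σ M = M σ / Σ_{τ < σ} im(cov (τ ≤ σ))`. -/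
theorem stmt12 {Λ V : Type} [CommRing Λ] [Fintype V] [DecidableEq V]
    (K : Finset (Finset V))
    (hsub : ∀ s ∈ K, ∀ t : Finset V, t ⊆ s → t ∈ K)
    (hempty : ∅ ∈ K)
    (M : Finset V → Type) [∀ s, AddCommGroup (M s)] [∀ s, Module Λ (M s)]
    (cov : ∀ σ τ : Finset V, σ ∈ K → τ ∈ K → σ ⊆ τ → (M σ →ₗ[Λ] M τ))
    (con : ∀ σ τ : Finset V, σ ∈ K → τ ∈ K → σ ⊆ τ → (M τ →ₗ[Λ] M σ))
    (hcov_id : ∀ σ (h : σ ∈ K), cov σ σ h h (subset_refl σ) = LinearMap.id)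
    (hcov_comp : ∀ σ τ ρ (hσ : σ ∈ K) (hτ : τ ∈ K) (hρ : ρ ∈ K)
      (h1 : σ ⊆ τ) (h2 : τ ⊆ ρ),
      (cov τ ρ hτ hρ h2).comp (cov σ τ hσ hτ h1) = cov σ ρ hσ hρ (h1.trans h2))
    (hcon_id : ∀ σ (h : σ ∈ K), con σ σ h h (subset_refl σ) = LinearMap.id)
    (hcon_comp : ∀ σ τ ρ (hσ : σ ∈ K) (hτ : τ ∈ K) (hρ : ρ ∈ K)
      (h1 : σ ⊆ τ) (h2 : τ ⊆ ρ),
      (con σ τ hσ hτ h1).comp (con τ ρ hτ hρ h2) = con σ ρ hσ hρ (h1.trans h2))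
    (hmackey : ∀ σ₁ σ₂ τ (h1 : σ₁ ∈ K) (h2 : σ₂ ∈ K) (hτ : τ ∈ K)
      (hs1 : σ₁ ⊆ τ) (hs2 : σ₂ ⊆ τ),
      (con σ₂ τ h2 hτ hs2).comp (cov σ₁ τ h1 hτ hs1)
        = (cov (σ₁ ∩ σ₂) σ₂ (hsub σ₂ h2 _ inter_subset_right) h2 inter_subset_right).comp
            (con (σ₁ ∩ σ₂) σ₁ (hsub σ₁ h1 _ inter_subset_left) h1 inter_subset_left))
    -- `N`, together with the maps `f_σ`, is a colimit of the covariant functor `M` over `P`: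
    (N : Type) [AddCommGroup N] [Module Λ N]
    (f : ∀ σ : Finset V, σ ∈ K → (M σ →ₗ[Λ] N))
    (hf : ∀ σ τ (hσ : σ ∈ K) (hτ : τ ∈ K) (h : σ ⊆ τ),
      (f τ hτ).comp (cov σ τ hσ hτ h) = f σ hσ)
    (huniv : ∀ (N' : Type) [AddCommGroup N'] [Module Λ N']
      (g : ∀ σ : Finset V, σ ∈ K → (M σ →ₗ[Λ] N')),
      (∀ σ τ (hσ : σ ∈ K) (hτ : τ ∈ K) (h : σ ⊆ τ),
        (g τ hτ).comp (cov σ τ hσ hτ h) = g σ hσ) →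
      ∃! φ : N →ₗ[Λ] N', ∀ σ (hσ : σ ∈ K), φ.comp (f σ hσ) = g σ hσ) :
    Nonempty (N ≃ₗ[Λ]
      (⨁ i : {s : Finset V // s ∈ K},
        M i.1 ⧸ (⨆ (μ : {s : Finset V // s ∈ K}) (h : μ.1 ⊂ i.1),
          LinearMap.range (cov μ.1 i.1 μ.2 i.2 h.subset)))) := by
  have con_cov : ∀ σ τ (hσ : σ ∈ K) (hτ : τ ∈ K) (h : σ ⊆ τ),
      (con σ τ hσ hτ h).comp (cov σ τ hσ hτ h) = LinearMap.id := by
    intro σ τ hσ hτ h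
    have aux : ∀ κ (hκ : κ ∈ K) (hκσ : κ ⊆ σ), κ = σ →
        (cov κ σ hκ hσ hκσ).comp (con κ σ hκ hσ hκσ) = LinearMap.id := by
      rintro κ hκ hκσ rfl
      rw [hcov_id, hcon_id, LinearMap.id_comp]
    rw [hmackey]
    exact aux _ _ _ (inter_self σ)
  let R (i : {s : Finset V // s ∈ K}) : Submodule Λ (M i.1) :=
    ⨆ (μ : {s : Finset V // s ∈ K}) (h : μ.1 ⊂ i.1),
      LinearMap.range (cov μ.1 i.1 μ.2 i.2 h.subset)
  have hR : ∀ (i μ : {s : Finset V // s ∈ K}) (h : μ.1 ⊂ i.1) (x : M μ.1),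
      cov μ.1 i.1 μ.2 i.2 h.subset x ∈ R i := fun i μ h x =>
    Submodule.mem_iSup_of_mem μ (Submodule.mem_iSup_of_mem h ⟨x, rfl⟩)
  -- restriction to `i` followed by the quotient map, as a cocone in `τ`
  let c (i : {s : Finset V // s ∈ K}) (τ : Finset V) (hτ : τ ∈ K) : M τ →ₗ[Λ] M i.1 ⧸ R i :=
    if h : i.1 ⊆ τ then (R i).mkQ.comp (con i.1 τ i.2 hτ h) else 0
  have hc : ∀ i σ τ (hσ : σ ∈ K) (hτ : τ ∈ K) (h : σ ⊆ τ),
      (c i τ hτ).comp (cov σ τ hσ hτ h) = c i σ hσ := by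
    intro i σ τ hσ hτ h
    by_cases hi : i.1 ⊆ σ
    · simp only [c, dif_pos hi, dif_pos (hi.trans h)]
      rw [← hcon_comp i.1 σ τ i.2 hσ hτ hi h, LinearMap.comp_assoc, LinearMap.comp_assoc,
        con_cov, LinearMap.comp_id]
    · simp only [c, dif_neg hi]
      by_cases hiτ : i.1 ⊆ τ
      · rw [dif_pos hiτ, LinearMap.comp_assoc, hmackey σ i.1 τ hσ i.2 hτ h hiτ]
        ext x
        refine (Submodule.Quotient.mk_eq_zero _).mpr
          (hR i ⟨σ ∩ i.1, hsub σ hσ _ inter_subset_left⟩ ?_ _)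
        exact inter_subset_right.ssubset_of_ne fun he => hi (inter_eq_right.mp he)
      · rw [dif_neg hiτ, LinearMap.zero_comp]
  have c_con : ∀ i σ τ (hσ : σ ∈ K) (hτ : τ ∈ K) (h : σ ⊆ τ) (x : M τ),
      c i σ hσ (con σ τ hσ hτ h x) = if i.1 ⊆ σ then c i τ hτ x else 0 := by
    intro i σ τ hσ hτ h x
    split_ifs with hi
    · simp only [c, dif_pos hi, dif_pos (hi.trans h)]
      rw [← hcon_comp i.1 σ τ i.2 hσ hτ hi h]
      rfl
    · simp only [c, dif_neg hi, LinearMap.zero_apply]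
  obtain ⟨Φ, hΦ, -⟩ := huniv (∀ i, M i.1 ⧸ R i) (fun τ hτ => LinearMap.pi fun i => c i τ hτ)
    (fun σ τ hσ hτ h => by
      rw [LinearMap.pi_comp]
      simp only [hc])
  have hΦ' : ∀ τ (hτ : τ ∈ K) (x : M τ) i, Φ (f τ hτ x) i = c i τ hτ x := fun τ hτ x i =>
    congrFun (LinearMap.congr_fun (hΦ τ hτ) x) i
  -- restriction to `ρ` followed by the structure map of the colimit
  let G (τ : Finset V) (hτ : τ ∈ K) (ρ : Finset V) : M τ →ₗ[Λ] N :=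
    if h : ρ ⊆ τ then (f ρ (hsub τ hτ ρ h)).comp (con ρ τ (hsub τ hτ ρ h) hτ h) else 0
  have G_cov : ∀ σ τ (hσ : σ ∈ K) (hτ : τ ∈ K) (h : σ ⊆ τ) ρ, ρ ⊆ τ → ∀ x : M σ,
      G τ hτ ρ (cov σ τ hσ hτ h x) = G σ hσ (σ ∩ ρ) x := by
    intro σ τ hσ hτ h ρ hρ x
    have hρK := hsub τ hτ ρ hρ
    simp only [G, dif_pos hρ, dif_pos (inter_subset_left : σ ∩ ρ ⊆ σ)]
    rw [← hf (σ ∩ ρ) ρ (hsub σ hσ _ inter_subset_left) hρK inter_subset_right]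
    exact congrArg (f ρ hρK) (LinearMap.congr_fun (hmackey σ ρ τ hσ hρK hτ h hρ) x)
  have G_con : ∀ σ τ (hσ : σ ∈ K) (hτ : τ ∈ K) (h : σ ⊆ τ) ρ, ρ ⊆ σ → ∀ x : M τ,
      G σ hσ ρ (con σ τ hσ hτ h x) = G τ hτ ρ x := by
    intro σ τ hσ hτ h ρ hρ x
    simp only [G, dif_pos hρ, dif_pos (hρ.trans h)]
    rw [← hcon_comp ρ σ τ (hsub σ hσ ρ hρ) hσ hτ hρ h]
    rfl
  have Φ_G : ∀ τ (hτ : τ ∈ K) ρ, ρ ⊆ τ → ∀ (x : M τ) i,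
      Φ (G τ hτ ρ x) i = if i.1 ⊆ ρ then c i τ hτ x else 0 := by
    intro τ hτ ρ hρ x i
    simp only [G, dif_pos hρ, LinearMap.comp_apply, hΦ', c_con]
  let P (τ : Finset V) (hτ : τ ∈ K) : M τ →ₗ[Λ] N :=
    (-1 : ℤ) ^ #τ • ∑ ρ ∈ τ.powerset, (-1 : ℤ) ^ #ρ • G τ hτ ρ
  have P_apply : ∀ τ (hτ : τ ∈ K) x,
      P τ hτ x = (-1 : ℤ) ^ #τ • ∑ ρ ∈ τ.powerset, (-1 : ℤ) ^ #ρ • G τ hτ ρ x := by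
    intro τ hτ x
    simp only [P, LinearMap.smul_apply, LinearMap.sum_apply]
  have P_ker : ∀ i, R i ≤ LinearMap.ker (P i.1 i.2) := by
    intro i
    refine iSup_le fun μ => iSup_le fun h => ?_
    rintro _ ⟨x, rfl⟩
    obtain ⟨v, hvi, hvμ⟩ := exists_of_ssubset h
    rw [LinearMap.mem_ker, P_apply, sum_congr rfl fun ρ hρ => by
      rw [G_cov μ.1 i.1 μ.2 i.2 h.subset ρ (mem_powerset.mp hρ) x],
      sum_powerset_neg_one_pow_smul_eq_zero hvi (fun ρ => G μ.1 μ.2 (μ.1 ∩ ρ) x), smul_zero]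
    intro t _
    simp only [inter_insert_of_notMem hvμ]
  have Φ_P : ∀ (j : {s : Finset V // s ∈ K}) (x : M j.1) i,
      Φ (P j.1 j.2 x) i = if i.1 = j.1 then c i j.1 j.2 x else 0 := by
    intro j x i
    rw [P_apply, map_zsmul, map_sum, Pi.smul_apply, Finset.sum_apply,
      sum_congr rfl fun ρ hρ => by
        rw [map_zsmul, Pi.smul_apply, Φ_G j.1 j.2 ρ (mem_powerset.mp hρ) x i],
      sum_powerset_neg_one_pow_smul_ite, smul_ite, smul_zero, smul_smul, ← mul_pow]
    simp
  let Ψ : (∀ i, M i.1 ⧸ R i) →ₗ[Λ] N :=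
    ∑ i, ((R i).liftQ (P i.1 i.2) (P_ker i)).comp (LinearMap.proj i)
  have ΦΨ : Φ.comp Ψ = LinearMap.id := by
    refine LinearMap.pi_ext' fun j => Submodule.linearMap_qext _ (LinearMap.ext fun x => ?_)
    have hΨ : Ψ (Pi.single j ((R j).mkQ x)) = P j.1 j.2 x := by
      simp only [Ψ, LinearMap.sum_apply, LinearMap.comp_apply, LinearMap.proj_apply]
      rw [sum_eq_single_of_mem j (mem_univ j)]
      · rw [Pi.single_eq_same]
        rfl
      · intro i _ hij
        rw [Pi.single_eq_of_ne hij, map_zero]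
    change Φ (Ψ (Pi.single j ((R j).mkQ x))) = Pi.single j ((R j).mkQ x)
    rw [hΨ]
    funext i
    rw [Φ_P]
    by_cases hij : i = j
    · subst hij
      rw [Pi.single_eq_same, if_pos rfl]
      simp only [c, dif_pos (subset_refl i.1), hcon_id, LinearMap.comp_id]
    · rw [Pi.single_eq_of_ne hij, if_neg fun h => hij (Subtype.ext h)]
  have P_con : ∀ τ (hτ : τ ∈ K) (x : M τ) i,
      (R i).liftQ (P i.1 i.2) (P_ker i) (c i τ hτ x) =
        if i.1 ⊆ τ then ∑ ρ ∈ τ.powerset,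
          (-1 : ℤ) ^ #i.1 • (if ρ ⊆ i.1 then (-1 : ℤ) ^ #ρ • G τ hτ ρ x else 0) else 0 := by
    intro τ hτ x i
    split_ifs with h
    · simp only [c, dif_pos h]
      change P i.1 i.2 (con i.1 τ i.2 hτ h x) = _
      rw [P_apply, sum_congr rfl fun ρ hρ => by
        rw [G_con i.1 τ i.2 hτ h ρ (mem_powerset.mp hρ) x], ← smul_sum, ← sum_filter]
      congr 1
      refine sum_congr (Finset.ext fun ρ => ?_) fun _ _ => rfl
      simp only [mem_filter, mem_powerset]
      exact ⟨fun hρ => ⟨hρ.trans h, hρ⟩, And.right⟩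
    · simp only [c, dif_neg h, LinearMap.zero_apply, map_zero]
  have ΨΦ_f : ∀ τ (hτ : τ ∈ K) (x : M τ), Ψ (Φ (f τ hτ x)) = f τ hτ x := by
    intro τ hτ x
    simp only [Ψ, LinearMap.sum_apply, LinearMap.comp_apply, LinearMap.proj_apply, hΦ', P_con]
    rw [sum_coe_sort K fun σ => if σ ⊆ τ then ∑ ρ ∈ τ.powerset,
      (-1 : ℤ) ^ #σ • (if ρ ⊆ σ then (-1 : ℤ) ^ #ρ • G τ hτ ρ x else 0) else 0, ← sum_filter]
    have hfilter : K.filter (· ⊆ τ) = τ.powerset := by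
      ext σ
      simp only [mem_filter, mem_powerset]
      exact ⟨And.right, fun h => ⟨hsub τ hτ σ h, h⟩⟩
    rw [hfilter, sum_comm]
    simp only [sum_powerset_neg_one_pow_smul_ite]
    rw [sum_ite_eq' τ.powerset τ, if_pos (mem_powerset_self τ), smul_smul, ← mul_pow]
    simp [G, hcon_id]
  have ΨΦ : Ψ.comp Φ = LinearMap.id :=
    (huniv N f hf).unique (fun σ hσ => LinearMap.ext fun x => ΨΦ_f σ hσ x)
      (fun σ hσ => LinearMap.id_comp _)
  let e : N ≃ₗ[Λ] (∀ i, M i.1 ⧸ R i) := LinearEquiv.ofLinearMap Φ Ψ ΦΨ ΨΦ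
  exact ⟨e.trans (DirectSum.linearEquivFunOnFintype Λ _ fun i => M i.1 ⧸ R i).symm⟩
end

section
/- Let Λ be a commutative ring, Σ a finite simplicial complex with simplex poset P (empty simplex included), and M = (M_*, M^*) a Mackey ΛP-module such that each M_*(σ) is a finitely generated module over a Noetherian ring Λ. Then in the Grothendieck group G₀ of finitely generated Λ-modules one has [colim_P M_*] = Σ_{σ∈P} n_σ · [M_*(σ)], where n_σ = Σ_{n≥0} (−1)^n · |ch_n(Σ,σ)| and ch_n(Σ,σ) is the set of chains σ = σ₀ < σ₁ < ⋯ < σ_n in P. -/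
open Finset

/-- If the weights `w` sum to one over every upper cone of a simplicial complex `K`, a valuation
of a supremum over `K` is the `w`-weighted sum of the values at the simplices. -/
theorem valuation_sup_eq_sum {V L A : Type*} [DecidableEq V] [Lattice L] [OrderBot L]
    [AddCommGroup A] (μ : L → A) (hbot : μ ⊥ = 0)
    (hmod : ∀ a b, μ (a ⊔ b) + μ (a ⊓ b) = μ a + μ b)
    (K : Finset (Finset V)) (hK : ∀ s ∈ K, ∀ t : Finset V, t ⊆ s → t ∈ K)
    (R : Finset V → L)
    (hR : ∀ S ⊆ K, ∀ τ ∈ K, S.sup R ⊓ R τ = S.sup fun σ => R (σ ∩ τ))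
    (w : Finset V → ℤ) (hw : ∀ ρ ∈ K, ∑ σ ∈ K with ρ ⊆ σ, w σ = 1) :
    μ (K.sup R) = ∑ σ ∈ K, w σ • μ (R σ) := by
  have key : ∀ S : Finset (Finset V), S ⊆ K → (∀ s ∈ S, ∀ t : Finset V, t ⊆ s → t ∈ S) →
      μ (S.sup R) = ∑ τ ∈ S, (μ (R τ) - μ (τ.ssubsets.sup R)) := by
    intro S
    induction S using Finset.strongInduction with
    | H S ih =>
      intro hSK hS
      rcases S.eq_empty_or_nonempty with rfl | hne
      · simp [hbot]
      obtain ⟨τ, hτ⟩ := S.exists_maximal hne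
      have hτS : τ ∈ S := hτ.1
      have hmax : ∀ σ ∈ S, τ ⊆ σ → σ = τ := fun σ hσ h => (hτ.eq_of_le hσ h).symm
      have hsub : S.erase τ ⊆ K := (S.erase_subset τ).trans hSK
      have h1 := ih (S.erase τ) (Finset.erase_ssubset hτS) hsub (by
        intro s hs t hts
        rw [Finset.mem_erase] at hs ⊢
        refine ⟨?_, hS s hs.2 t hts⟩
        rintro rfl
        exact hs.1 (hmax s hs.2 hts))
      have h2 : (S.erase τ).sup R ⊓ R τ = τ.ssubsets.sup R := by
        rw [hR _ hsub τ (hSK hτS)]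
        apply le_antisymm
        · refine Finset.sup_le fun σ hσ => ?_
          rw [Finset.mem_erase] at hσ
          refine Finset.le_sup (f := R) (Finset.mem_ssubsets.2 ?_)
          refine (Finset.inter_subset_right).ssubset_of_ne fun h => hσ.1 (hmax σ hσ.2 ?_)
          exact Finset.inter_eq_right.1 h
        · refine Finset.sup_le fun σ hσ => ?_
          rw [Finset.mem_ssubsets] at hσ
          have : R σ = R (σ ∩ τ) := by rw [Finset.inter_eq_left.2 hσ.subset]
          rw [this]
          exact Finset.le_sup (f := fun σ => R (σ ∩ τ))
            (Finset.mem_erase.2 ⟨hσ.ne, hS τ hτS σ hσ.subset⟩)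
      have h3 := hmod ((S.erase τ).sup R) (R τ)
      have h4 : S.sup R = (S.erase τ).sup R ⊔ R τ := by
        conv_lhs => rw [← Finset.insert_erase hτS, Finset.sup_insert, sup_comm]
      rw [h2, ← h4, h1] at h3
      rw [← Finset.sum_erase_add S _ hτS, ← add_sub_assoc, ← h3, add_sub_cancel_right]
  have hpow : ∀ τ ∈ K, μ (R τ) = ∑ ρ ∈ K with ρ ⊆ τ, (μ (R ρ) - μ (ρ.ssubsets.sup R)) := by
    intro τ hτ
    rw [← key _ (Finset.filter_subset _ _)]
    · congr 1
      apply le_antisymm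
      · exact Finset.le_sup (f := R) (Finset.mem_filter.2 ⟨hτ, subset_rfl⟩)
      · refine Finset.sup_le fun σ hσ => ?_
        rw [Finset.mem_filter] at hσ
        have := hR {σ} (by simpa using hσ.1) τ hτ
        simp only [Finset.sup_singleton, Finset.inter_eq_left.2 hσ.2] at this
        exact inf_eq_left.1 this
    · intro s hs t hts
      rw [Finset.mem_filter] at hs ⊢
      exact ⟨hK s hs.1 t hts, hts.trans hs.2⟩
  rw [key K subset_rfl hK, Finset.sum_congr rfl fun σ hσ => congrArg (w σ • ·) (hpow σ hσ)]
  simp_rw [Finset.smul_sum, Finset.sum_filter]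
  rw [Finset.sum_comm]
  refine Finset.sum_congr rfl fun ρ hρ => ?_
  rw [← Finset.sum_filter, ← Finset.sum_smul, hw ρ hρ, one_smul]

/-- The strict chains of `n + 1` elements of `K` starting at `σ`. -/
abbrev ChainFrom {V : Type*} (K : Finset (Finset V)) (n : ℕ) (σ : Finset V) : Type _ :=
  {c : Fin (n + 1) → Finset V // c 0 = σ ∧ (∀ i, c i ∈ K) ∧ ∀ i j, i < j → c i ⊂ c j}

theorem card_chainFrom_zero {V : Type*} {K : Finset (Finset V)} {σ : Finset V} (hσ : σ ∈ K) :
    Nat.card (ChainFrom K 0 σ) = 1 := by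
  rw [Nat.card_eq_one_iff_unique]
  refine ⟨⟨fun a b => ?_⟩, ⟨⟨fun _ => σ, rfl, fun _ => hσ, ?_⟩⟩⟩
  · ext1
    funext i
    rw [Fin.fin_one_eq_zero i, a.2.1, b.2.1]
  · intro i j h
    omega

/-- Deleting the first element of a chain. -/
def chainFromSuccEquiv {V : Type*} {K : Finset (Finset V)} {σ : Finset V} (hσ : σ ∈ K) (n : ℕ) :
    ChainFrom K (n + 1) σ ≃ Σ τ : {τ : Finset V // τ ∈ K ∧ σ ⊂ τ}, ChainFrom K n τ.1 where
  toFun c := ⟨⟨c.1 1, c.2.2.1 1, by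
      have := c.2.2.2 0 1 (by simp)
      rwa [c.2.1] at this⟩,
    ⟨fun i => c.1 i.succ, rfl, fun i => c.2.2.1 _,
      fun i j h => c.2.2.2 _ _ (Fin.succ_lt_succ_iff.2 h)⟩⟩
  invFun p := ⟨Fin.cons σ p.2.1, rfl, fun i => by
      cases i using Fin.cases with
      | zero => exact hσ
      | succ i => exact p.2.2.2.1 i, fun i j h => by
      cases j using Fin.cases with
      | zero => exact absurd h (Fin.not_lt_zero i)
      | succ j =>
        cases i using Fin.cases with
        | succ i => exact p.2.2.2.2 i j (Fin.succ_lt_succ_iff.1 h)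
        | zero =>
          refine p.1.2.2.trans_subset ?_
          rw [Fin.cons_succ]
          rcases (Fin.zero_le j).eq_or_lt with rfl | hj
          · exact p.2.2.1.ge
          · have := (p.2.2.2.2 0 j hj).subset
            rwa [p.2.2.1] at this⟩
  left_inv c := by
    ext1
    funext i
    cases i using Fin.cases with
    | zero => exact c.2.1.symm
    | succ i => rfl
  right_inv := by
    rintro ⟨⟨τ, hτ⟩, c, hc, h⟩
    change c 0 = τ at hc
    subst hc
    rfl

theorem card_chainFrom_succ {V : Type*} [Fintype V] [DecidableEq V] {K : Finset (Finset V)}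
    {σ : Finset V} (hσ : σ ∈ K) (n : ℕ) :
    Nat.card (ChainFrom K (n + 1) σ) = ∑ τ ∈ K with σ ⊂ τ, Nat.card (ChainFrom K n τ) := by
  rw [Nat.card_congr (chainFromSuccEquiv hσ n), Nat.card_sigma]
  exact (Finset.sum_subtype (K.filter (σ ⊂ ·)) (fun τ => Finset.mem_filter)
    (fun τ => Nat.card (ChainFrom K n τ))).symm

theorem card_chainFrom_eq_zero {V : Type*} [Fintype V] {K : Finset (Finset V)} (σ : Finset V) :
    Nat.card (ChainFrom K (Fintype.card V + 1) σ) = 0 := by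
  have : IsEmpty (ChainFrom K (Fintype.card V + 1) σ) := by
    refine ⟨fun c => ?_⟩
    have hle : ∀ m (h : m < Fintype.card V + 1 + 1), m ≤ (c.1 ⟨m, h⟩).card := by
      intro m
      induction m with
      | zero => simp
      | succ m ih =>
        intro h
        have := Finset.card_lt_card (c.2.2.2 ⟨m, by omega⟩ ⟨m + 1, h⟩ (by simp))
        have := ih (by omega)
        omega
    have h1 := hle (Fintype.card V + 1) (by omega)
    have h2 := Finset.card_le_univ (c.1 ⟨Fintype.card V + 1, by omega⟩)
    omega
  exact Nat.card_of_isEmpty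

/-- The alternating chain counts sum to one over every upper cone. -/
theorem sum_alternating_card_chainFrom {V : Type*} [Fintype V] [DecidableEq V]
    {K : Finset (Finset V)} {ρ : Finset V} (hρ : ρ ∈ K) :
    ∑ σ ∈ K with ρ ⊆ σ, ∑ n ∈ Finset.range (Fintype.card V + 1),
      (-1 : ℤ) ^ n * (Nat.card (ChainFrom K n σ) : ℤ) = 1 := by
  have hsplit : K.filter (ρ ⊆ ·) = insert ρ (K.filter (ρ ⊂ ·)) := by
    ext σ
    simp only [Finset.mem_filter, Finset.mem_insert]
    constructor
    · rintro ⟨h1, h2⟩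
      rcases h2.eq_or_ssubset with rfl | h
      · exact Or.inl rfl
      · exact Or.inr ⟨h1, h⟩
    · rintro (rfl | ⟨h1, h2⟩)
      · exact ⟨hρ, subset_rfl⟩
      · exact ⟨h1, h2.subset⟩
  have hrec : ∑ n ∈ Finset.range (Fintype.card V + 1),
      (-1 : ℤ) ^ n * (Nat.card (ChainFrom K n ρ) : ℤ) =
      1 - ∑ σ ∈ K with ρ ⊂ σ, ∑ n ∈ Finset.range (Fintype.card V + 1),
        (-1 : ℤ) ^ n * (Nat.card (ChainFrom K n σ) : ℤ) := by
    have h := Finset.sum_range_succ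
      (fun n => (-1 : ℤ) ^ n * (Nat.card (ChainFrom K n ρ) : ℤ)) (Fintype.card V + 1)
    rw [card_chainFrom_eq_zero, Nat.cast_zero, mul_zero, add_zero] at h
    rw [← h, Finset.sum_range_succ', card_chainFrom_zero hρ, Finset.sum_comm]
    simp_rw [card_chainFrom_succ hρ, Nat.cast_sum, Finset.mul_sum, pow_succ]
    simp only [mul_neg, mul_one, neg_mul, Finset.sum_neg_distrib]
    simp
    ring
  rw [hsplit, Finset.sum_insert (by simp), hrec, sub_add_cancel]

/-- An additive invariant of finitely generated modules is a valuation on the submodules of a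
Noetherian module. -/
theorem additive_invariant_sup_add_inf {Λ : Type} [CommRing Λ] {A : Type*} [AddCommGroup A]
    (φ : ∀ (N : Type) [AddCommGroup N] [Module Λ N], A)
    (hadd : ∀ (N₀ N₁ N₂ : Type) [AddCommGroup N₀] [Module Λ N₀] [AddCommGroup N₁]
      [Module Λ N₁] [AddCommGroup N₂] [Module Λ N₂],
      Module.Finite Λ N₀ → Module.Finite Λ N₁ → Module.Finite Λ N₂ →
      ∀ (u : N₀ →ₗ[Λ] N₁) (v : N₁ →ₗ[Λ] N₂),
        Function.Injective u → Function.Surjective v → LinearMap.range u = LinearMap.ker v →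
        φ N₁ = φ N₀ + φ N₂)
    {N : Type} [AddCommGroup N] [Module Λ N] [IsNoetherian Λ N] (X Y : Submodule Λ N) :
    φ ↥(X ⊔ Y) + φ ↥(X ⊓ Y) = φ X + φ Y := by
  have key : ∀ Z : Submodule Λ N, φ Z = φ ↥(X ⊓ Z) + φ ↥(Z.map X.mkQ) := by
    intro Z
    refine hadd _ _ _ inferInstance inferInstance inferInstance
      (Submodule.inclusion inf_le_right) (X.mkQ.submoduleMap Z)
      (Submodule.inclusion_injective _) (X.mkQ.submoduleMap_surjective Z) ?_
    ext z
    rw [Submodule.range_inclusion, LinearMap.mem_ker, Submodule.mem_comap,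
      ← Submodule.coe_eq_zero, LinearMap.submoduleMap_coe_apply]
    simp
  have h1 := key (X ⊔ Y)
  have h2 : (X ⊔ Y).map X.mkQ = Y.map X.mkQ := by simp [Submodule.map_sup]
  rw [h2, inf_sup_self] at h1
  rw [h1, key Y]
  abel

/-- Let `Λ` be a commutative Noetherian ring, `P` the simplex poset (empty simplex included)
of a finite simplicial complex — modelled as a subset-closed collection `K` of finite subsets
of a finite vertex set `V` — and `(M, cov, con)` a Mackey `ΛP`-module with each `M σ` a
finitely generated `Λ`-module.  Then in the Grothendieck group `G₀` of finitely generated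
`Λ`-modules (expressed universally: for every homomorphism-like assignment `φ` of values in
an abelian group `A` which is invariant under isomorphism and additive on short exact
sequences of finitely generated modules) one has
`[colim_P M] = Σ_{σ∈P} n_σ·[M σ]`, where `n_σ = Σ_{n≥0} (−1)^n·|ch_n(Σ,σ)|` and
`ch_n(Σ,σ)` is the set of chains `σ = σ₀ ⊂ σ₁ ⊂ ⋯ ⊂ σ_n` in `P`.  The colimit is given by
a module `N` with maps `f_σ` satisfying the universal property. -/
theorem stmt16 {Λ V : Type} [CommRing Λ] [IsNoetherianRing Λ] [Fintype V] [DecidableEq V]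
    (K : Finset (Finset V))
    (hsub : ∀ s ∈ K, ∀ t : Finset V, t ⊆ s → t ∈ K)
    (hempty : ∅ ∈ K)
    (M : Finset V → Type) [∀ s, AddCommGroup (M s)] [∀ s, Module Λ (M s)]
    (hfg : ∀ s ∈ K, Module.Finite Λ (M s))
    (cov : ∀ σ τ : Finset V, σ ∈ K → τ ∈ K → σ ⊆ τ → (M σ →ₗ[Λ] M τ))
    (con : ∀ σ τ : Finset V, σ ∈ K → τ ∈ K → σ ⊆ τ → (M τ →ₗ[Λ] M σ))
    (hcov_id : ∀ σ (h : σ ∈ K), cov σ σ h h (subset_refl σ) = LinearMap.id)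
    (hcov_comp : ∀ σ τ ρ (hσ : σ ∈ K) (hτ : τ ∈ K) (hρ : ρ ∈ K)
      (h1 : σ ⊆ τ) (h2 : τ ⊆ ρ),
      (cov τ ρ hτ hρ h2).comp (cov σ τ hσ hτ h1) = cov σ ρ hσ hρ (h1.trans h2))
    (hcon_id : ∀ σ (h : σ ∈ K), con σ σ h h (subset_refl σ) = LinearMap.id)
    (hcon_comp : ∀ σ τ ρ (hσ : σ ∈ K) (hτ : τ ∈ K) (hρ : ρ ∈ K)
      (h1 : σ ⊆ τ) (h2 : τ ⊆ ρ),
      (con σ τ hσ hτ h1).comp (con τ ρ hτ hρ h2) = con σ ρ hσ hρ (h1.trans h2))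
    (hmackey : ∀ σ₁ σ₂ τ (h1 : σ₁ ∈ K) (h2 : σ₂ ∈ K) (hτ : τ ∈ K)
      (hs1 : σ₁ ⊆ τ) (hs2 : σ₂ ⊆ τ),
      (con σ₂ τ h2 hτ hs2).comp (cov σ₁ τ h1 hτ hs1)
        = (cov (σ₁ ∩ σ₂) σ₂ (hsub σ₂ h2 _ inter_subset_right) h2 inter_subset_right).comp
            (con (σ₁ ∩ σ₂) σ₁ (hsub σ₁ h1 _ inter_subset_left) h1 inter_subset_left))
    -- `N`, together with the maps `f_σ`, is a colimit of the covariant functor `M` over `P`: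
    (N : Type) [AddCommGroup N] [Module Λ N]
    (f : ∀ σ : Finset V, σ ∈ K → (M σ →ₗ[Λ] N))
    (hf : ∀ σ τ (hσ : σ ∈ K) (hτ : τ ∈ K) (h : σ ⊆ τ),
      (f τ hτ).comp (cov σ τ hσ hτ h) = f σ hσ)
    (huniv : ∀ (N' : Type) [AddCommGroup N'] [Module Λ N']
      (g : ∀ σ : Finset V, σ ∈ K → (M σ →ₗ[Λ] N')),
      (∀ σ τ (hσ : σ ∈ K) (hτ : τ ∈ K) (h : σ ⊆ τ),
        (g τ hτ).comp (cov σ τ hσ hτ h) = g σ hσ) →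
      ∃! φ : N →ₗ[Λ] N', ∀ σ (hσ : σ ∈ K), φ.comp (f σ hσ) = g σ hσ)
    -- the integers `n_σ`:
    (nn : Finset V → ℤ)
    (hnn : ∀ σ : Finset V, nn σ = ∑ n ∈ Finset.range (Fintype.card V + 1), (-1 : ℤ) ^ n *
      (Fintype.card {c : Fin (n + 1) → Finset V //
        c 0 = σ ∧ (∀ i, c i ∈ K) ∧ ∀ i j, i < j → c i ⊂ c j} : ℤ))
    -- a `G₀`-valued invariant of finitely generated `Λ`-modules:
    (A : Type) [AddCommGroup A]
    (φ : ∀ (N' : Type) [AddCommGroup N'] [Module Λ N'], A)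
    (hiso : ∀ (N₁ N₂ : Type) [AddCommGroup N₁] [Module Λ N₁] [AddCommGroup N₂] [Module Λ N₂],
      Module.Finite Λ N₁ → (N₁ ≃ₗ[Λ] N₂) → φ N₁ = φ N₂)
    (hadd : ∀ (N₀ N₁ N₂ : Type) [AddCommGroup N₀] [Module Λ N₀] [AddCommGroup N₁]
      [Module Λ N₁] [AddCommGroup N₂] [Module Λ N₂],
      Module.Finite Λ N₀ → Module.Finite Λ N₁ → Module.Finite Λ N₂ →
      ∀ (u : N₀ →ₗ[Λ] N₁) (v : N₁ →ₗ[Λ] N₂),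
        Function.Injective u → Function.Surjective v → LinearMap.range u = LinearMap.ker v →
        φ N₁ = φ N₀ + φ N₂) :
    φ N = ∑ σ ∈ K.attach, nn σ.1 • φ (M σ.1) := by
  have hcongr : ∀ σ τ s t (hσ : σ ∈ K) (hτ : τ ∈ K) (hs : s ∈ K) (ht : t ∈ K)
      (h1 : s ⊆ σ) (h2 : s ⊆ τ) (h3 : t ⊆ σ) (h4 : t ⊆ τ), s = t →
      (cov s σ hs hσ h1).comp (con s τ hs hτ h2)
        = (cov t σ ht hσ h3).comp (con t τ ht hτ h4) := by
    rintro σ τ s _ hσ hτ hs ht h1 h2 h3 h4 rfl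
    rfl
  have hr : ∀ σ (hσ : σ ∈ K), ∃ r : N →ₗ[Λ] M σ, ∀ τ (hτ : τ ∈ K),
      r.comp (f τ hτ) = (cov (σ ∩ τ) σ (hsub σ hσ _ inter_subset_left) hσ
        inter_subset_left).comp
        (con (σ ∩ τ) τ (hsub σ hσ _ inter_subset_left) hτ inter_subset_right) := by
    intro σ hσ
    refine (huniv (M σ) (fun τ hτ => (cov (σ ∩ τ) σ (hsub σ hσ _ inter_subset_left) hσ
        inter_subset_left).comp
        (con (σ ∩ τ) τ (hsub σ hσ _ inter_subset_left) hτ inter_subset_right)) ?_).exists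
    intro τ τ' hτ hτ' h
    rw [LinearMap.comp_assoc, hmackey τ (σ ∩ τ') τ' hτ _ hτ' h inter_subset_right,
      ← LinearMap.comp_assoc, hcov_comp]
    refine hcongr _ _ _ _ _ _ _ _ _ _ _ _ ?_
    rw [Finset.inter_left_comm, Finset.inter_eq_left.2 h]
  choose r hr using hr
  have hrf : ∀ σ hσ, (r σ hσ).comp (f σ hσ) = LinearMap.id := by
    intro σ hσ
    rw [hr, hcongr σ σ (σ ∩ σ) σ hσ hσ _ hσ _ _ subset_rfl subset_rfl (Finset.inter_self σ),
      hcov_id, hcon_id, LinearMap.id_comp]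
  have hfr : ∀ σ τ hσ hτ y, f τ hτ (r τ hτ (f σ hσ y)) =
      f (σ ∩ τ) (hsub σ hσ _ inter_subset_left)
        (con (σ ∩ τ) σ (hsub σ hσ _ inter_subset_left) hσ inter_subset_left y) := by
    intro σ τ hσ hτ y
    rw [← LinearMap.comp_apply (r τ hτ), hr, hcongr τ σ (τ ∩ σ) (σ ∩ τ) hτ hσ _
      (hsub σ hσ _ inter_subset_left) _ _ inter_subset_right inter_subset_left
      (Finset.inter_comm τ σ), LinearMap.comp_apply, ← LinearMap.comp_apply (f τ hτ), hf]
  let R : Finset V → Submodule Λ N := fun σ => ⨆ h : σ ∈ K, LinearMap.range (f σ h)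
  have hRdef : ∀ σ (h : σ ∈ K), R σ = LinearMap.range (f σ h) := fun σ h => iSup_pos h
  have htop : K.sup R = ⊤ := by
    have h0 : ∀ σ (hσ : σ ∈ K), (K.sup R).mkQ.comp (f σ hσ) = 0 := by
      intro σ hσ
      rw [← LinearMap.range_le_ker_iff, Submodule.ker_mkQ, ← hRdef]
      exact Finset.le_sup hσ
    have := (huniv (N ⧸ K.sup R) (fun σ hσ => 0) (by simp)).unique (y₁ := (K.sup R).mkQ)
      (y₂ := 0) h0 (by simp)
    rw [← Submodule.ker_mkQ (K.sup R), this, LinearMap.ker_zero]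
  have hNfin : Module.Finite Λ N := by
    refine ⟨?_⟩
    rw [← htop]
    refine Submodule.fg_finset_sup K R fun σ hσ => ?_
    rw [hRdef σ hσ]
    have := hfg σ hσ
    exact Module.Finite.iff_fg.1 inferInstance
  have hNnoeth : IsNoetherian Λ N := isNoetherian_of_isNoetherianRing_of_finite Λ N
  have hinj : ∀ σ hσ, Function.Injective (f σ hσ) := fun σ hσ =>
    Function.LeftInverse.injective (g := r σ hσ) fun x => LinearMap.congr_fun (hrf σ hσ) x
  have hR : ∀ S ⊆ K, ∀ τ ∈ K, S.sup R ⊓ R τ = S.sup fun σ => R (σ ∩ τ) := by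
    intro S hS τ hτ
    apply le_antisymm
    · rintro x ⟨hx, hxτ⟩
      have h1 : (S.sup R).map ((f τ hτ).comp (r τ hτ)) ≤ S.sup fun σ => R (σ ∩ τ) := by
        rw [Submodule.map_le_iff_le_comap]
        refine Finset.sup_le fun σ hσ => ?_
        rw [hRdef σ (hS hσ)]
        rintro _ ⟨y, rfl⟩
        refine Finset.le_sup (f := fun σ => R (σ ∩ τ)) hσ ?_
        rw [LinearMap.comp_apply, hfr]
        simp only [hRdef (σ ∩ τ) (hsub σ (hS hσ) _ inter_subset_left)]
        exact LinearMap.mem_range_self _ _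
      rw [SetLike.mem_coe, hRdef τ hτ] at hxτ
      obtain ⟨z, rfl⟩ := hxτ
      have h2 := h1 (Submodule.mem_map_of_mem hx)
      rwa [LinearMap.comp_apply, ← LinearMap.comp_apply (r τ hτ), hrf, LinearMap.id_apply] at h2
    · refine Finset.sup_le fun σ hσ => ?_
      have hmono : ∀ ρ (hρ : ρ ∈ K), σ ∩ τ ⊆ ρ → R (σ ∩ τ) ≤ R ρ := by
        intro ρ hρ h
        rw [hRdef ρ hρ, hRdef _ (hsub ρ hρ _ h), ← hf _ _ (hsub ρ hρ _ h) hρ h]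
        exact LinearMap.range_comp_le_range _ _
      exact le_inf ((hmono σ (hS hσ) inter_subset_left).trans (Finset.le_sup hσ))
        (hmono τ hτ inter_subset_right)
  have hbot : φ ↥(⊥ : Submodule Λ N) = 0 := by
    have h := hadd ↥(⊥ : Submodule Λ N) ↥(⊥ : Submodule Λ N) ↥(⊥ : Submodule Λ N)
      inferInstance inferInstance inferInstance 0 0
      (Function.injective_of_subsingleton _) (Function.surjective_to_subsingleton _)
      (Subsingleton.elim _ _)
    exact left_eq_add.1 h
  have hw : ∀ ρ ∈ K, ∑ σ ∈ K with ρ ⊆ σ, nn σ = 1 := by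
    intro ρ hρ
    rw [← sum_alternating_card_chainFrom hρ]
    refine Finset.sum_congr rfl fun σ _ => ?_
    simp only [hnn, Nat.card_eq_fintype_card]
  have hmain := valuation_sup_eq_sum (fun X : Submodule Λ N => φ X) hbot
    (additive_invariant_sup_add_inf φ hadd) K hsub R hR nn hw
  rw [Finset.sum_attach K fun σ => nn σ • φ (M σ), hiso N _ hNfin Submodule.topEquiv.symm,
    ← htop, hmain]
  refine Finset.sum_congr rfl fun σ hσ => ?_
  rw [hRdef σ hσ, hiso _ _ (hfg σ hσ) (LinearEquiv.ofInjective (f σ hσ) (hinj σ hσ))]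
end
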